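/- Let N be a nonnegative integer, Λ ∈ ℂ with Re Λ ≥ N, ν ∈ ℝ with ν ≥ −N, and 0 < ε < 1. Let ψ be a smooth function on (0,1) with ψ(t) = 0 for 0 < t < ε and ψ^{(k)} integrable on (0,1) for 0 ≤ k ≤ N, and set φ(t) = (1 − t)^Λ ψ(t). For 0 ≤ k ≤ N define I_k(r) = ∫₀¹ s^{ν+k+1} φ^{(k)}(s²) J_{ν+k}(rs) ds. Then for every r > 0, I₀(r) = (−2/r)^N · I_N(r). -/

import Mathlib

open MeasureTheory Filter Set

/-- The Bessel function of the first kind `J_ν(x)`, for `x > 0` defined by the series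
`Σ_{k≥0} (-1)^k / (k! Γ(ν+k+1)) (x/2)^{2k+ν}`, powers via the real logarithm of `x/2`. -/
noncomputable def besselJ (ν : ℂ) (x : ℝ) : ℂ :=
  ∑' k : ℕ, ((-1) ^ k / ((Nat.factorial k : ℂ) * Complex.Gamma (ν + k + 1))) *
    ((x / 2 : ℂ) ^ (2 * (k : ℂ) + ν))


noncomputable def bcoef (a r : ℝ) (j : ℕ) : ℂ :=
  ((-1) ^ j / ((Nat.factorial j : ℂ) * Complex.Gamma ((a : ℂ) + j + 1))) *
    (((r / 2) ^ (2 * (j : ℝ) + a) : ℝ) : ℂ)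

noncomputable def bF (a r t : ℝ) : ℂ := ∑' j : ℕ, bcoef a r j * ((t ^ ((j : ℝ) + a) : ℝ) : ℂ)

lemma bF_eq (a r t : ℝ) (hr : 0 < r) (ht : 0 < t) :
    ((t ^ a : ℝ) : ℂ) * besselJ (a : ℂ) (r * t) = bF a r (t ^ 2) := by
  unfold besselJ bF
  rw [← tsum_mul_left]
  congr 1
  ext j
  have h1 : ((r * t : ℝ) / 2 : ℂ) ^ (2 * (j : ℂ) + a) =
      (((r / 2) ^ (2 * (j : ℝ) + a) * t ^ (2 * (j : ℝ) + a) : ℝ) : ℂ) := by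
    rw [← Real.mul_rpow (by positivity) ht.le, Complex.ofReal_cpow (by positivity)]
    push_cast
    congr 1
    ring
  have h2 : (t ^ 2) ^ ((j : ℝ) + a) = t ^ a * t ^ (2 * (j : ℝ) + a) := by
    rw [← Real.rpow_natCast t 2, ← Real.rpow_mul ht.le, ← Real.rpow_add ht]
    congr 1
    push_cast
    ring
  rw [h1, h2, bcoef]
  push_cast
  ring

lemma bcoef_succ_a (a r : ℝ) (hr : 0 < r) (j : ℕ) :
    bcoef (a + 1) r j * (((j : ℝ) + (a + 1) : ℝ) : ℂ) = (r / 2 : ℂ) * bcoef a r j := by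
  unfold bcoef
  have h := Complex.one_div_Gamma_eq_self_mul_one_div_Gamma_add_one ((a : ℂ) + j + 1)
  have h3 : (r / 2) ^ (2 * (j : ℝ) + (a + 1)) = (r / 2) * (r / 2) ^ (2 * (j : ℝ) + a) := by
    rw [← add_assoc, Real.rpow_add_one (by positivity)]
    ring
  have h4 : (((a + 1 : ℝ) : ℂ) + j + 1) = (a : ℂ) + j + 1 + 1 := by push_cast; ring
  rw [h3, h4]
  generalize (r / 2) ^ (2 * (j : ℝ) + a) = P
  simp only [div_eq_mul_inv, mul_inv, h]
  push_cast
  ring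

lemma bcoef_succ_j (a r : ℝ) (hr : 0 < r) (j : ℕ) :
    bcoef a r (j + 1) * (((j : ℝ) + 1) * ((j : ℝ) + a + 1) : ℝ) =
      -((r / 2) ^ 2 : ℝ) * bcoef a r j := by
  unfold bcoef
  have h := Complex.one_div_Gamma_eq_self_mul_one_div_Gamma_add_one ((a : ℂ) + j + 1)
  have h3 : (r / 2) ^ (2 * ((j + 1 : ℕ) : ℝ) + a) = (r / 2) ^ 2 * (r / 2) ^ (2 * (j : ℝ) + a) := by
    rw [← Real.rpow_natCast (r / 2) 2, ← Real.rpow_add (by positivity)]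
    congr 1
    push_cast
    ring
  have h4 : (a : ℂ) + ((j + 1 : ℕ) : ℂ) + 1 = (a : ℂ) + j + 1 + 1 := by push_cast; ring
  have h5 : (j : ℂ) + 1 ≠ 0 := Nat.cast_add_one_ne_zero j
  rw [Nat.factorial_succ]
  rw [h3, h4]
  generalize (r / 2) ^ (2 * (j : ℝ) + a) = P
  simp only [div_eq_mul_inv, mul_inv, h]
  push_cast
  field_simp
  ring

lemma bcoef_summable (a r M : ℝ) (hr : 0 < r) (hM : 0 < M) :
    Summable (fun j : ℕ => ‖bcoef a r j‖ * M ^ j) := by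
  apply summable_of_ratio_norm_eventually_le (r := 1 / 2) (by norm_num)
  have h1 : ∀ᶠ j : ℕ in atTop, 2 * ((r / 2) ^ 2 * M) ≤ (j : ℝ) :=
    tendsto_natCast_atTop_atTop.eventually_ge_atTop _
  have h2 : ∀ᶠ j : ℕ in atTop, -a ≤ (j : ℝ) :=
    tendsto_natCast_atTop_atTop.eventually_ge_atTop _
  filter_upwards [h1, h2] with j hj1 hj2
  have h := congrArg norm (bcoef_succ_j a r hr j)
  rw [norm_mul, norm_mul, norm_neg, Complex.norm_real, Complex.norm_real,
    Real.norm_of_nonneg (by positivity : (0:ℝ) ≤ (r / 2) ^ 2),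
    Real.norm_of_nonneg (mul_nonneg (by positivity) (by linarith))] at h
  have hn : 0 ≤ ‖bcoef a r j‖ := norm_nonneg _
  have hn1 : 0 ≤ ‖bcoef a r (j + 1)‖ := norm_nonneg _
  rw [Real.norm_of_nonneg (by positivity), Real.norm_of_nonneg (by positivity), pow_succ]
  have hj0 : (0:ℝ) ≤ j := Nat.cast_nonneg j
  have hK : 0 < (r / 2) ^ 2 * M := by positivity
  have key : ‖bcoef a r (j + 1)‖ * M ≤ 1 / 2 * ‖bcoef a r j‖ := by
    have e1 : ‖bcoef a r (j + 1)‖ * (j + 1) ≤ (r / 2) ^ 2 * ‖bcoef a r j‖ := by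
      rw [← h, ← mul_assoc]
      exact le_mul_of_one_le_right (by positivity) (by linarith)
    have e2 : ‖bcoef a r (j + 1)‖ * M * (j + 1) ≤ 1 / 2 * ‖bcoef a r j‖ * (j + 1) := by
      calc ‖bcoef a r (j + 1)‖ * M * (j + 1) = ‖bcoef a r (j + 1)‖ * (j + 1) * M := by ring
        _ ≤ (r / 2) ^ 2 * ‖bcoef a r j‖ * M := by gcongr
        _ = ((r / 2) ^ 2 * M) * ‖bcoef a r j‖ := by ring
        _ ≤ (1 / 2 * (j + 1)) * ‖bcoef a r j‖ :=
            mul_le_mul_of_nonneg_right (by linarith) hn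
        _ = _ := by ring
    exact le_of_mul_le_mul_right e2 (by positivity)
  calc _ = ‖bcoef a r (j + 1)‖ * M * M ^ j := by ring
    _ ≤ 1 / 2 * ‖bcoef a r j‖ * M ^ j := by gcongr
    _ = _ := by ring

lemma bF_hasDerivAt (a r t : ℝ) (hr : 0 < r) (ht : 0 < t) :
    HasDerivAt (bF (a + 1) r) ((r / 2 : ℂ) * bF a r t) t := by
  have hb : ∀ b y : ℝ, y ∈ Ioo (t / 2) (2 * t) → ∀ j : ℕ,
      ‖bcoef b r j * ((y ^ ((j : ℝ) + b) : ℝ) : ℂ)‖ ≤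
        ((t / 2) ^ b + (2 * t) ^ b) * (‖bcoef b r j‖ * (2 * t) ^ j) := by
    intro b y hy j
    have hy0 : 0 < y := by linarith [hy.1]
    have hyb : y ^ b ≤ (t / 2) ^ b + (2 * t) ^ b := by
      rcases le_total 0 b with h | h
      · have := Real.rpow_le_rpow hy0.le hy.2.le h
        have h0 : 0 ≤ (t / 2) ^ b := by positivity
        linarith
      · have := Real.rpow_le_rpow_of_nonpos (by positivity : 0 < t / 2) hy.1.le h
        have h0 : 0 ≤ (2 * t) ^ b := by positivity
        linarith
    have hyj : y ^ j ≤ (2 * t) ^ j := pow_le_pow_left₀ hy0.le hy.2.le j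
    rw [norm_mul, Complex.norm_real, Real.norm_of_nonneg (by positivity), Real.rpow_add hy0,
      Real.rpow_natCast]
    calc _ ≤ ‖bcoef b r j‖ * ((2 * t) ^ j * ((t / 2) ^ b + (2 * t) ^ b)) := by gcongr
      _ = _ := by ring
  have htm : t ∈ Ioo (t / 2) (2 * t) := ⟨by linarith, by linarith⟩
  unfold bF
  rw [← tsum_mul_left]
  refine hasDerivAt_tsum_of_isPreconnected
    (g := fun j y => bcoef (a + 1) r j * ((y ^ ((j : ℝ) + (a + 1)) : ℝ) : ℂ))
    (g' := fun j y => (r / 2 : ℂ) * (bcoef a r j * ((y ^ ((j : ℝ) + a) : ℝ) : ℂ)))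
    (u := fun j => ‖(r / 2 : ℂ)‖ *
      (((t / 2) ^ a + (2 * t) ^ a) * (‖bcoef a r j‖ * (2 * t) ^ j)))
    (t := Ioo (t / 2) (2 * t)) (y₀ := t) ?_ isOpen_Ioo isPreconnected_Ioo ?_ ?_ htm ?_ htm
  · exact ((bcoef_summable a r (2 * t) hr (by positivity)).mul_left _).mul_left _
  · intro j y hy
    have hy0 : 0 < y := by linarith [hy.1]
    have h := ((Real.hasDerivAt_rpow_const (x := y) (p := (j : ℝ) + (a + 1))
      (Or.inl hy0.ne')).ofReal_comp).const_mul (bcoef (a + 1) r j)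
    refine h.congr_deriv ?_
    symm
    rw [Complex.ofReal_mul, ← mul_assoc, ← mul_assoc, bcoef_succ_a a r hr j]
    congr 3
    ring
  · intro j y hy
    rw [norm_mul]
    gcongr
    exact hb a y hy j
  · exact Summable.of_norm_bounded
      ((bcoef_summable (a + 1) r (2 * t) hr (by positivity)).mul_left _) (hb (a + 1) t htm)

lemma bF_continuousOn (a r : ℝ) (hr : 0 < r) : ContinuousOn (bF a r) (Ioi 0) := by
  intro t ht
  have := bF_hasDerivAt (a - 1) r t hr ht
  rw [sub_add_cancel] at this
  exact this.continuousAt.continuousWithinAt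

lemma itd_hasDerivAt (f : ℝ → ℂ) (hf : ContDiffOn ℝ (⊤ : ℕ∞) f (Ioo 0 1)) (k : ℕ) (t : ℝ)
    (ht : t ∈ Ioo (0:ℝ) 1) :
    HasDerivAt (iteratedDerivWithin k f (Ioo 0 1)) (iteratedDerivWithin (k + 1) f (Ioo 0 1) t) t := by
  have h := hf.differentiableOn_iteratedDerivWithin (m := k)
    (by exact_mod_cast WithTop.coe_lt_top k) (uniqueDiffOn_Ioo 0 1) t ht
  have h1 := h.hasDerivWithinAt
  rw [← iteratedDerivWithin_succ] at h1
  exact h1.hasDerivAt (Ioo_mem_nhds ht.1 ht.2)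

lemma itd_zero (f : ℝ → ℂ) (ε : ℝ) (h0 : ∀ t ∈ Ioo (0:ℝ) ε, f t = 0) (k : ℕ) (t : ℝ)
    (ht : t ∈ Ioo (0:ℝ) ε) : iteratedDerivWithin k f (Ioo 0 1) t = 0 := by
  have h : f =ᶠ[nhdsWithin t (Ioo 0 1)] (fun _ => (0:ℂ)) := by
    filter_upwards [mem_nhdsWithin_of_mem_nhds (Ioo_mem_nhds ht.1 ht.2)] with x hx using h0 x hx
  rw [h.iteratedDerivWithin_eq (h0 t ht)]
  simp

lemma pow_hasDerivAt (Λ : ℂ) (t : ℝ) (ht : t < 1) :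
    HasDerivAt (fun t : ℝ => ((1 - t : ℝ) : ℂ) ^ Λ) (-Λ * ((1 - t : ℝ) : ℂ) ^ (Λ - 1)) t := by
  have h1 : HasDerivAt (fun t : ℝ => ((1 - t : ℝ) : ℂ)) ((-1 : ℝ) : ℂ) t := by
    apply HasDerivAt.ofReal_comp
    simpa using (hasDerivAt_id t).const_sub 1
  have h2 : ((1 - t : ℝ) : ℂ) ∈ Complex.slitPlane := by
    rw [Complex.ofReal_mem_slitPlane]; linarith
  have h3 := HasDerivAt.comp_of_eq t (h₂ := fun z : ℂ => z ^ Λ)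
    ((hasDerivAt_id ((1 - t : ℝ) : ℂ)).cpow_const (c := Λ) h2) h1 rfl
  refine h3.congr_deriv ?_
  simp

lemma pow_contDiffOn (n : ℕ) : ∀ Λ : ℂ,
    ContDiffOn ℝ n (fun t : ℝ => ((1 - t : ℝ) : ℂ) ^ Λ) (Ioo 0 1) := by
  induction n with
  | zero =>
    intro Λ
    rw [Nat.cast_zero, contDiffOn_zero]
    intro t ht
    exact (pow_hasDerivAt Λ t ht.2).continuousAt.continuousWithinAt
  | succ n ih =>
    intro Λ
    rw [Nat.cast_succ, contDiffOn_succ_iff_deriv_of_isOpen isOpen_Ioo]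
    refine ⟨fun t ht => (pow_hasDerivAt Λ t ht.2).differentiableAt.differentiableWithinAt,
      by simp, ?_⟩
    refine ((contDiffOn_const (c := -Λ)).mul (ih (Λ - 1))).congr ?_
    intro t ht
    exact (pow_hasDerivAt Λ t ht.2).deriv

lemma pow_itd (Λ : ℂ) (k : ℕ) : ∃ c : ℂ, ∀ t ∈ Ioo (0:ℝ) 1,
    iteratedDerivWithin k (fun t : ℝ => ((1 - t : ℝ) : ℂ) ^ Λ) (Ioo 0 1) t =
      c * ((1 - t : ℝ) : ℂ) ^ (Λ - k) := by
  induction k with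
  | zero => exact ⟨1, fun t ht => by simp⟩
  | succ k ih =>
    obtain ⟨c, hc⟩ := ih
    refine ⟨c * (-(Λ - k)), fun t ht => ?_⟩
    rw [iteratedDerivWithin_succ, derivWithin_congr hc (hc t ht),
      derivWithin_of_isOpen isOpen_Ioo ht,
      ((pow_hasDerivAt (Λ - k) t ht.2).const_mul c).deriv]
    push_cast
    rw [mul_assoc, sub_sub]

lemma itd_mul (Λ : ℂ) (ψ : ℝ → ℂ) (hψ : ContDiffOn ℝ (⊤ : ℕ∞) ψ (Ioo 0 1))
    (φ : ℝ → ℂ) (hφ : ∀ t : ℝ, φ t = ((1 - t : ℝ) : ℂ) ^ Λ * ψ t) (k : ℕ) :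
    ∃ c : ℕ → ℂ, ∀ t ∈ Ioo (0:ℝ) 1, iteratedDerivWithin k φ (Ioo 0 1) t =
      ∑ i ∈ Finset.range (k + 1), (c i * ((1 - t : ℝ) : ℂ) ^ (Λ - i)) *
        iteratedDerivWithin (k - i) ψ (Ioo 0 1) t := by
  choose c hc using pow_itd Λ
  refine ⟨fun i => (k.choose i : ℂ) * c i, fun t ht => ?_⟩
  have e : φ = (fun t : ℝ => ((1 - t : ℝ) : ℂ) ^ Λ) * ψ := by ext t; exact hφ t
  rw [e, iteratedDerivWithin_mul ht (uniqueDiffOn_Ioo 0 1) (pow_contDiffOn k Λ t ht)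
    ((hψ t ht).of_le (by exact_mod_cast le_top))]
  refine Finset.sum_congr rfl fun i _ => ?_
  rw [hc i t ht]
  ring

lemma phi_contDiffOn (Λ : ℂ) (ψ : ℝ → ℂ) (hψ : ContDiffOn ℝ (⊤ : ℕ∞) ψ (Ioo 0 1))
    (φ : ℝ → ℂ) (hφ : ∀ t : ℝ, φ t = ((1 - t : ℝ) : ℂ) ^ Λ * ψ t) :
    ContDiffOn ℝ (⊤ : ℕ∞) φ (Ioo 0 1) := by
  have e : φ = fun t => ((1 - t : ℝ) : ℂ) ^ Λ * ψ t := by ext t; exact hφ t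
  rw [e]
  exact (contDiffOn_infty.2 fun n => pow_contDiffOn n Λ).mul hψ

lemma pow_continuousOn (Λ : ℂ) :
    ContinuousOn (fun t : ℝ => ((1 - t : ℝ) : ℂ) ^ Λ) (Ioo 0 1) :=
  fun t ht => (pow_hasDerivAt Λ t ht.2).continuousAt.continuousWithinAt

lemma phi_integrable (N : ℕ) (Λ : ℂ) (hΛ : (N : ℝ) ≤ Λ.re)
    (ψ : ℝ → ℂ) (hψ : ContDiffOn ℝ (⊤ : ℕ∞) ψ (Ioo 0 1))
    (hψint : ∀ k : ℕ, k ≤ N →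
      IntegrableOn (iteratedDerivWithin k ψ (Ioo 0 1)) (Ioo (0:ℝ) 1))
    (φ : ℝ → ℂ) (hφ : ∀ t : ℝ, φ t = ((1 - t : ℝ) : ℂ) ^ Λ * ψ t) (k : ℕ) (hk : k ≤ N) :
    IntegrableOn (iteratedDerivWithin k φ (Ioo 0 1)) (Ioo (0:ℝ) 1) := by
  obtain ⟨c, hc⟩ := itd_mul Λ ψ hψ φ hφ k
  rw [integrableOn_congr_fun hc measurableSet_Ioo]
  refine integrable_finsetSum _ fun i hi => ?_
  have hik : i ≤ k := by simpa [Nat.lt_succ_iff] using hi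
  refine Integrable.bdd_mul (c := ‖c i‖) (hψint (k - i) (by omega)) ?_ ?_
  · exact (continuousOn_const.mul (pow_continuousOn _)).aestronglyMeasurable measurableSet_Ioo
  · rw [ae_restrict_iff' measurableSet_Ioo]
    refine Eventually.of_forall fun t ht => ?_
    rw [norm_mul, Complex.norm_cpow_eq_rpow_re_of_pos (by linarith [ht.2])]
    refine mul_le_of_le_one_right (norm_nonneg _) ?_
    refine Real.rpow_le_one (by linarith [ht.2]) (by linarith [ht.1]) ?_
    have : (i : ℝ) ≤ N := by exact_mod_cast hik.trans hk
    simp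
    linarith

lemma psi_bdd (N : ℕ) (ψ : ℝ → ℂ) (hψ : ContDiffOn ℝ (⊤ : ℕ∞) ψ (Ioo 0 1))
    (hψint : ∀ k : ℕ, k ≤ N →
      IntegrableOn (iteratedDerivWithin k ψ (Ioo 0 1)) (Ioo (0:ℝ) 1)) (k : ℕ) (hk : k < N) :
    ∃ C : ℝ, ∀ t ∈ Ioo (1 / 2 : ℝ) 1, ‖iteratedDerivWithin k ψ (Ioo 0 1) t‖ ≤ C := by
  refine ⟨‖iteratedDerivWithin k ψ (Ioo 0 1) (1 / 2)‖ +
    ∫ s in Ioo (0:ℝ) 1, ‖iteratedDerivWithin (k + 1) ψ (Ioo 0 1) s‖, fun t ht => ?_⟩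
  have hI := hψint (k + 1) hk
  have hsub : Ioc (1 / 2 : ℝ) t ⊆ Ioo 0 1 := fun x hx =>
    ⟨by linarith [hx.1], by linarith [hx.2, ht.2]⟩
  have h := intervalIntegral.integral_eq_sub_of_hasDerivAt (a := 1 / 2) (b := t)
    (f := iteratedDerivWithin k ψ (Ioo 0 1)) (f' := iteratedDerivWithin (k + 1) ψ (Ioo 0 1))
    (fun x hx => by
      rw [uIcc_of_le ht.1.le] at hx
      exact itd_hasDerivAt ψ hψ k x ⟨by linarith [hx.1], by linarith [hx.2, ht.2]⟩)
    ((intervalIntegrable_iff_integrableOn_Ioc_of_le ht.1.le).2 (hI.mono_set hsub))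
  rw [intervalIntegral.integral_of_le ht.1.le] at h
  have h2 : ‖∫ y in Ioc (1 / 2 : ℝ) t, iteratedDerivWithin (k + 1) ψ (Ioo 0 1) y‖ ≤
      ∫ s in Ioo (0:ℝ) 1, ‖iteratedDerivWithin (k + 1) ψ (Ioo 0 1) s‖ :=
    (norm_integral_le_integral_norm _).trans
      (setIntegral_mono_set hI.norm (Eventually.of_forall fun _ => norm_nonneg _)
        hsub.eventuallyLE)
  have h3 : iteratedDerivWithin k ψ (Ioo 0 1) t = iteratedDerivWithin k ψ (Ioo 0 1) (1 / 2) +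
      ∫ y in Ioc (1 / 2 : ℝ) t, iteratedDerivWithin (k + 1) ψ (Ioo 0 1) y := by rw [h]; ring
  rw [h3]
  exact (norm_add_le _ _).trans (by gcongr)

lemma phi_tendsto (N : ℕ) (Λ : ℂ) (hΛ : (N : ℝ) ≤ Λ.re)
    (ψ : ℝ → ℂ) (hψ : ContDiffOn ℝ (⊤ : ℕ∞) ψ (Ioo 0 1))
    (hψint : ∀ k : ℕ, k ≤ N →
      IntegrableOn (iteratedDerivWithin k ψ (Ioo 0 1)) (Ioo (0:ℝ) 1))
    (φ : ℝ → ℂ) (hφ : ∀ t : ℝ, φ t = ((1 - t : ℝ) : ℂ) ^ Λ * ψ t) (k : ℕ) (hk : k < N) :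
    Tendsto (iteratedDerivWithin k φ (Ioo 0 1)) (nhdsWithin 1 (Iio 1)) (nhds 0) := by
  obtain ⟨c, hc⟩ := itd_mul Λ ψ hψ φ hφ k
  have hmem : Ioo (1 / 2 : ℝ) 1 ∈ nhdsWithin (1:ℝ) (Iio 1) :=
    Ioo_mem_nhdsLT (by norm_num)
  have he : (fun t : ℝ => ∑ i ∈ Finset.range (k + 1), (c i * ((1 - t : ℝ) : ℂ) ^ (Λ - i)) *
        iteratedDerivWithin (k - i) ψ (Ioo 0 1) t) =ᶠ[nhdsWithin 1 (Iio 1)]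
      iteratedDerivWithin k φ (Ioo 0 1) := by
    filter_upwards [hmem] with t ht
    exact (hc t ⟨by linarith [ht.1], ht.2⟩).symm
  refine Tendsto.congr' he ?_
  rw [← Finset.sum_const_zero (M := ℂ) (s := Finset.range (k + 1))]
  refine tendsto_finsetSum (M := ℂ) _ fun i hi => ?_
  have hik : i ≤ k := by simpa [Nat.lt_succ_iff] using hi
  obtain ⟨C, hC⟩ := psi_bdd N ψ hψ hψint (k - i) (by omega)
  have hpos : 0 < Λ.re - i := by
    have : (i : ℝ) < N := by exact_mod_cast lt_of_le_of_lt hik hk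
    linarith
  have hlim : Tendsto (fun t : ℝ => ‖c i‖ * (1 - t) ^ (Λ.re - i) * C)
      (nhdsWithin 1 (Iio 1)) (nhds 0) := by
    have hcont : ContinuousAt (fun t : ℝ => ‖c i‖ * (1 - t) ^ (Λ.re - i) * C) 1 := by
      refine (continuousAt_const.mul (ContinuousAt.rpow_const ?_ (Or.inr hpos.le))).mul
        continuousAt_const
      fun_prop
    have := hcont.tendsto
    simp only [sub_self, Real.zero_rpow hpos.ne', mul_zero, zero_mul] at this
    exact this.mono_left nhdsWithin_le_nhds
  refine squeeze_zero_norm' ?_ hlim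
  filter_upwards [hmem] with t ht
  rw [norm_mul, norm_mul, Complex.norm_cpow_eq_rpow_re_of_pos (by linarith [ht.2])]
  have e : (Λ - i).re = Λ.re - i := by simp
  rw [e]
  have h1 : 0 ≤ (1 - t) ^ (Λ.re - i) := Real.rpow_nonneg (by linarith [ht.2]) _
  gcongr
  exact hC t ht

lemma prod_integrable (f F : ℝ → ℂ) (ε : ℝ) (hε : 0 < ε)
    (hf : IntegrableOn f (Ioo 0 1)) (h0 : ∀ t ∈ Ioo (0:ℝ) ε, f t = 0)
    (hF : ContinuousOn F (Ioi 0)) : IntegrableOn (fun t => f t * F t) (Ioo 0 1) := by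
  have h1 : IntegrableOn (fun t => f t * F t) (Ioo 0 ε) := by
    rw [integrableOn_congr_fun (g := fun _ => (0:ℂ)) (fun t ht => by simp [h0 t ht])
      measurableSet_Ioo]
    exact integrableOn_zero
  have h2 : IntegrableOn (fun t => f t * F t) (Ico ε 1) := by
    have hf2 : IntegrableOn f (Ico ε 1) := hf.mono_set fun x hx => ⟨by linarith [hx.1], hx.2⟩
    have hf3 : IntegrableOn f (Icc ε 1) := by
      rwa [integrableOn_Icc_iff_integrableOn_Ico]
    refine (hf3.mul_continuousOn (hF.mono ?_) isCompact_Icc).mono_set Ico_subset_Icc_self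
    intro x hx
    exact lt_of_lt_of_le hε hx.1
  refine (h1.union h2).mono_set ?_
  intro x hx
  rcases lt_or_ge x ε with h | h
  · exact Or.inl ⟨hx.1, h⟩
  · exact Or.inr ⟨h, hx.2⟩

lemma subst_sq (g : ℝ → ℂ) :
    ∫ t in Ioo (0:ℝ) 1, g t = ∫ s in Ioo (0:ℝ) 1, (2 * s : ℂ) * g (s ^ 2) := by
  have him : (fun s : ℝ => s ^ 2) '' Ioo 0 1 = Ioo 0 1 := by
    ext x
    constructor
    · rintro ⟨s, hs, rfl⟩
      exact ⟨by have := hs.1; positivity, by nlinarith [hs.1, hs.2]⟩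
    · intro hx
      refine ⟨√x, ⟨Real.sqrt_pos.2 hx.1, ?_⟩, Real.sq_sqrt hx.1.le⟩
      rw [Real.sqrt_lt' one_pos]
      simpa using hx.2
  have h := integral_image_eq_integral_abs_deriv_smul (f := fun s : ℝ => s ^ 2)
    (f' := fun s => 2 * s) (measurableSet_Ioo (a := (0:ℝ)) (b := 1))
    (fun x _ => by simpa using (hasDerivAt_pow 2 x).hasDerivWithinAt)
    (fun x hx y hy hxy => by
      exact (pow_left_inj₀ hx.1.le hy.1.le two_ne_zero).1 hxy) g
  rw [him] at h
  rw [h]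
  refine setIntegral_congr_fun measurableSet_Ioo fun s hs => ?_
  have : 0 < 2 * s := by linarith [hs.1]
  simp only [abs_of_pos this, Complex.real_smul]
  push_cast
  ring

/-- With `φ(t) = (1-t)^Λ ψ(t)` as in the boundary-decay proposition, setting
`I_k(r) = ∫₀¹ s^{ν+k+1} φ^{(k)}(s²) J_{ν+k}(rs) ds` for `0 ≤ k ≤ N`, one has
`I₀(r) = (-2/r)^N I_N(r)` for every `r > 0`. -/
theorem finite_hankel_recurrence (N : ℕ) (Λ : ℂ) (hΛ : (N : ℝ) ≤ Λ.re)
    (ν : ℝ) (hν : -(N : ℝ) ≤ ν)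
    (ε : ℝ) (hε : 0 < ε) (hε' : ε < 1)
    (ψ : ℝ → ℂ) (hψ : ContDiffOn ℝ (⊤ : ℕ∞) ψ (Set.Ioo 0 1))
    (hψ0 : ∀ t ∈ Set.Ioo (0:ℝ) ε, ψ t = 0)
    (hψint : ∀ k : ℕ, k ≤ N →
      IntegrableOn (iteratedDerivWithin k ψ (Set.Ioo 0 1)) (Set.Ioo (0:ℝ) 1))
    (φ : ℝ → ℂ) (hφ : ∀ t : ℝ, φ t = ((1 - t : ℝ) : ℂ) ^ Λ * ψ t)
    (I : ℕ → ℝ → ℂ)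
    (hI : ∀ k : ℕ, k ≤ N → ∀ r : ℝ, I k r =
      ∫ s in (0:ℝ)..1, ((s ^ (ν + k + 1) : ℝ) : ℂ) *
        iteratedDerivWithin k φ (Set.Ioo 0 1) (s ^ 2) * besselJ ((ν : ℂ) + k) (r * s)) :
    ∀ r : ℝ, 0 < r → I 0 r = (-2 / (r : ℂ)) ^ N * I N r := by
  intro r hr
  have hform : ∀ k : ℕ, k ≤ N → I k r = (1 / 2 : ℂ) *
      ∫ t in Ioo (0:ℝ) 1, iteratedDerivWithin k φ (Ioo 0 1) t * bF (ν + k) r t := by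
    intro k hk
    rw [hI k hk r, subst_sq, ← integral_const_mul, intervalIntegral.integral_of_le zero_le_one,
      integral_Ioc_eq_integral_Ioo]
    refine setIntegral_congr_fun measurableSet_Ioo fun s hs => ?_
    have h1 := bF_eq (ν + k) r s hr hs.1
    have h2 : s ^ (ν + k + 1) = s ^ (ν + k) * s := Real.rpow_add_one hs.1.ne' _
    rw [← h1, h2]
    push_cast
    ring
  have hφs := phi_contDiffOn Λ ψ hψ φ hφ
  have hφ0 : ∀ t ∈ Ioo (0:ℝ) ε, φ t = 0 := fun t ht => by rw [hφ, hψ0 t ht, mul_zero]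
  have hrc : (r : ℂ) ≠ 0 := by exact_mod_cast hr.ne'
  have hstep : ∀ k : ℕ, k < N → I k r = (-2 / (r : ℂ)) * I (k + 1) r := by
    intro k hk
    rw [hform k hk.le, hform (k + 1) hk]
    have hc : ν + ((k + 1 : ℕ) : ℝ) = ν + k + 1 := by push_cast; ring
    rw [hc]
    have i1 := prod_integrable _ (bF (ν + k) r) ε hε
      (phi_integrable N Λ hΛ ψ hψ hψint φ hφ k hk.le)
      (itd_zero φ ε hφ0 k) (bF_continuousOn _ r hr)
    have i2 := prod_integrable _ (bF (ν + k + 1) r) ε hε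
      (phi_integrable N Λ hΛ ψ hψ hψint φ hφ (k + 1) hk)
      (itd_zero φ ε hφ0 (k + 1)) (bF_continuousOn _ r hr)
    have i1' := i1.const_mul (r / 2 : ℂ)
    have key := intervalIntegral.integral_eq_sub_of_hasDerivAt_of_tendsto
      (a := 0) (b := 1) (fa := 0) (fb := 0) zero_lt_one
      (f := fun t => iteratedDerivWithin k φ (Ioo 0 1) t * bF (ν + k + 1) r t)
      (f' := fun t => iteratedDerivWithin (k + 1) φ (Ioo 0 1) t * bF (ν + k + 1) r t +
        (r / 2 : ℂ) * (iteratedDerivWithin k φ (Ioo 0 1) t * bF (ν + k) r t))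
      (fun t ht => by
        have := (itd_hasDerivAt φ hφs k t ht).mul (bF_hasDerivAt (ν + k) r t hr ht.1)
        refine this.congr_deriv ?_
        ring)
      (by
        rw [intervalIntegrable_iff_integrableOn_Ioo_of_le zero_le_one]
        exact i2.add i1')
      (by
        refine Tendsto.congr' ?_ tendsto_const_nhds
        filter_upwards [Ioo_mem_nhdsGT hε] with t ht
        rw [itd_zero φ ε hφ0 k t ht, zero_mul])
      (by
        have h1 := phi_tendsto N Λ hΛ ψ hψ hψint φ hφ k hk
        have h2 := (bF_hasDerivAt (ν + k) r 1 hr one_pos).continuousAt.tendsto.mono_left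
          (nhdsWithin_le_nhds (s := Iio 1))
        simpa using h1.mul h2)
    rw [intervalIntegral.integral_of_le zero_le_one, integral_Ioc_eq_integral_Ioo,
      integral_add i2 i1', integral_const_mul, sub_zero] at key
    rw [eq_neg_of_add_eq_zero_left key]
    field_simp
  have hind : ∀ k : ℕ, k ≤ N → I 0 r = (-2 / (r : ℂ)) ^ k * I k r := by
    intro k
    induction k with
    | zero => intro _; simp
    | succ k ih =>
      intro hk
      rw [ih (by omega), hstep k hk, pow_succ, mul_assoc]
  exact hind N le_rfl
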